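/- Let Ω ⊂ P(ℝ^d) be a properly convex domain with Hilbert metric d_Ω. Suppose (x_n) and (y_n) are sequences in Ω with x_n → x ∈ closure(Ω) and y_n → y ∈ closure(Ω). If liminf_{n→∞} d_Ω(x_n, y_n) < +∞, then y ∈ F_Ω(x) and d_{F_Ω(x)}(x, y) ≤ liminf_{n→∞} d_Ω(x_n, y_n). -/

import Mathlib

open Set Filter

noncomputable section

/-- Real projective space `P(ℝ^d)`, with the quotient topology. -/
abbrev PSpace (d : ℕ) := Projectivization ℝ (Fin d → ℝ)

instance PSpace.instTopologicalSpace (d : ℕ) : TopologicalSpace (PSpace d) :=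
  inferInstanceAs (TopologicalSpace (Quotient (projectivizationSetoid ℝ (Fin d → ℝ))))

namespace Paper

variable {d : ℕ}

/-- Inhomogeneous coordinates in the affine chart determined by the linear functional `f`:
a projective point `[v]` with `f v ≠ 0` is sent to the representative `v / f v` lying in the
affine hyperplane `{f = 1}`. -/
def chartMap (f : (Fin d → ℝ) →ₗ[ℝ] ℝ) (x : PSpace d) : Fin d → ℝ :=
  (f x.rep)⁻¹ • x.rep

/-- A subset of `P(ℝ^d)` is properly convex if there is an affine chart in which it is a
bounded convex set. -/
def IsProperlyConvex (C : Set (PSpace d)) : Prop :=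
  ∃ f : (Fin d → ℝ) →ₗ[ℝ] ℝ, (∀ x ∈ closure C, f x.rep ≠ 0) ∧
    Convex ℝ (chartMap f '' C) ∧ Bornology.IsBounded (chartMap f '' C)

/-- A properly convex domain: an open, nonempty, properly convex subset of `P(ℝ^d)`. -/
def IsPCDomain (Ω : Set (PSpace d)) : Prop :=
  IsOpen Ω ∧ Ω.Nonempty ∧ IsProperlyConvex Ω

open Classical in
/-- A choice of an affine chart containing the properly convex set `C`. -/
def chartOf (C : Set (PSpace d)) : (Fin d → ℝ) →ₗ[ℝ] ℝ :=
  if h : IsProperlyConvex C then h.choose else 0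

/-- The chart map associated to the chosen chart of `C`. -/
def cmap (C : Set (PSpace d)) : PSpace d → Fin d → ℝ := chartMap (chartOf C)

/-- The Hilbert distance between `u` and `v` computed in an affine chart where the convex set
is `O`: writing the line through `u, v` as `t ↦ u + t(v-u)`, with boundary parameters
`tm = inf {t | u + t(v-u) ∈ O} ≤ 0` and `tp = sup {...} ≥ 1`, the cross-ratio
`[a,u,v,b]` of `a = u + tm(v-u), u, v, b = u + tp(v-u)` equals `(tp(1-tm))/((-tm)(tp-1))`. -/
def hilbertDistChart (O : Set (Fin d → ℝ)) (u v : Fin d → ℝ) : ℝ :=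
  if u = v then 0
  else
    (1 / 2) * Real.log
      ((sSup {t : ℝ | u + t • (v - u) ∈ O} * (1 - sInf {t : ℝ | u + t • (v - u) ∈ O})) /
        ((-(sInf {t : ℝ | u + t • (v - u) ∈ O})) * (sSup {t : ℝ | u + t • (v - u) ∈ O} - 1)))

/-- The Hilbert metric of a properly convex set `C` (open in its span). -/
def hilbertDist (C : Set (PSpace d)) (x y : PSpace d) : ℝ :=
  hilbertDistChart (cmap C '' C) (cmap C x) (cmap C y)

/-- The closed projective line segment `[x,y]` contained in `closure C`. -/
def projSeg (C : Set (PSpace d)) (x y : PSpace d) : Set (PSpace d) :=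
  {z ∈ closure C | cmap C z ∈ segment ℝ (cmap C x) (cmap C y)}

/-- The open projective line segment `(x,y)` contained in `closure C`. -/
def projOpenSeg (C : Set (PSpace d)) (x y : PSpace d) : Set (PSpace d) :=
  {z ∈ closure C | cmap C z ∈ openSegment ℝ (cmap C x) (cmap C y)}

/-- The open face `F_C(x)` of a point `x ∈ closure C`: the set `{x}` together with all
`y ∈ closure C` such that some open line segment contained in `closure C` contains
both `x` and `y`. -/
def face (C : Set (PSpace d)) (x : PSpace d) : Set (PSpace d) :=
  insert x {y ∈ closure C | ∃ a ∈ closure C, ∃ b ∈ closure C,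
    x ∈ projOpenSeg C a b ∧ y ∈ projOpenSeg C a b}

/-- The ideal boundary `∂_i C = closure C \ C`. -/
def idealBdry (C : Set (PSpace d)) : Set (PSpace d) := closure C \ C

/-- The dimension of a subset `B`, computed in the chart of the ambient convex set `C`. -/
def pdimIn (C B : Set (PSpace d)) : ℕ :=
  Module.finrank ℝ (affineSpan ℝ (cmap C '' B)).direction

/-- The dimension of a convex subset of `P(ℝ^d)`. -/
def pdim (A : Set (PSpace d)) : ℕ := pdimIn A A

/-- The coarse dimension `cdim_C(A)` of a nonempty subset `A` of a properly convex set `C`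
open in its span: the smallest `k` such that `A` is contained in an `R`-neighborhood (for the
Hilbert metric of `C`) of a `k`-dimensional convex subset `B ⊆ C`. -/
def cdim (C A : Set (PSpace d)) : ℕ :=
  sInf {k : ℕ | ∃ R : ℝ, 0 < R ∧ ∃ B : Set (PSpace d), B ⊆ C ∧
    Convex ℝ (cmap C '' B) ∧ pdimIn C B = k ∧
    A ⊆ {p ∈ C | ∃ q ∈ B, hilbertDist C p q < R}}

/-- The cone over the standard open `(p-1)`-dimensional simplex: vectors whose first `p`
coordinates are positive and whose remaining coordinates vanish. -/
def simplexCone (p : ℕ) : Set (Fin d → ℝ) :=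
  {v | (∀ i : Fin d, (i : ℕ) < p → 0 < v i) ∧ ∀ i : Fin d, p ≤ (i : ℕ) → v i = 0}

/-- `S` is the image under `g ∈ PGL_d(ℝ)` of the standard open simplex with `p` vertices. -/
def IsSimplexWithMap (p : ℕ) (S : Set (PSpace d)) (g : (Fin d → ℝ) ≃ₗ[ℝ] (Fin d → ℝ)) : Prop :=
  S = {q : PSpace d | ∃ v ∈ simplexCone (d := d) p, ∃ hv : v ≠ 0,
        q = Projectivization.mk ℝ (g v) (by simpa using hv)}

/-- `S ⊆ P(ℝ^d)` is a simplex of dimension `k`. -/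
def IsSimplexOfDim (k : ℕ) (S : Set (PSpace d)) : Prop :=
  k + 1 ≤ d ∧ ∃ g : (Fin d → ℝ) ≃ₗ[ℝ] (Fin d → ℝ), IsSimplexWithMap (k + 1) S g

/-- `S` is a simplex with vertices `v 0, …, v (p-1)` (so of dimension `p - 1`). -/
def HasVertices {p : ℕ} (S : Set (PSpace d)) (v : Fin p → PSpace d) : Prop :=
  ∃ (hp : p ≤ d) (g : (Fin d → ℝ) ≃ₗ[ℝ] (Fin d → ℝ)),
    IsSimplexWithMap p S g ∧
    ∀ j : Fin p, v j = Projectivization.mk ℝ (g (Pi.single (Fin.castLE hp j) 1))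
      (by
        simp only [ne_eq, EmbeddingLike.map_eq_zero_iff]
        intro h
        have h1 := congrFun h (Fin.castLE hp j)
        rw [Pi.single_eq_same] at h1
        exact one_ne_zero (α := ℝ) h1)

/-- `A ⊆ B` is properly embedded if the inclusion map `A ↪ B` is proper. -/
def IsProperlyEmbedded (A B : Set (PSpace d)) : Prop :=
  ∃ h : A ⊆ B, IsProperMap (Set.inclusion h)

/-- The projective action of `GL(ℝ^d)` (hence of `PGL_d(ℝ)`) on `P(ℝ^d)`. -/
def pact (g : (Fin d → ℝ) ≃ₗ[ℝ] (Fin d → ℝ)) : PSpace d → PSpace d :=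
  Projectivization.map g.toLinearMap g.injective

/-- A naive convex co-compact triple `(Ω, C, Λ)`. -/
structure NCCTriple (d : ℕ) where
  Ω : Set (PSpace d)
  C : Set (PSpace d)
  Λ : Subgroup ((Fin d → ℝ) ≃ₗ[ℝ] (Fin d → ℝ))
  isOpen_Ω : IsOpen Ω
  nonempty_Ω : Ω.Nonempty
  properlyConvex_Ω : IsProperlyConvex Ω
  inv_Ω : ∀ g ∈ Λ, pact g '' Ω = Ω
  infinite_Λ : (Λ : Set ((Fin d → ℝ) ≃ₗ[ℝ] (Fin d → ℝ))).Infinite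
  discrete_Λ : ∀ K ⊆ Ω, IsCompact K →
    {g : (Fin d → ℝ) ≃ₗ[ℝ] (Fin d → ℝ) | g ∈ Λ ∧ (pact g '' K ∩ K).Nonempty}.Finite
  C_nonempty : C.Nonempty
  C_sub : C ⊆ Ω
  C_closedInΩ : closure C ∩ Ω ⊆ C
  C_convex : Convex ℝ (cmap Ω '' C)
  inv_C : ∀ g ∈ Λ, pact g '' C = C
  cocompact : ∃ K : Set (PSpace d), K ⊆ C ∧ IsCompact K ∧ C ⊆ ⋃ g ∈ Λ, pact g '' K

/-- The orbit of a point under a subgroup of `PGL_d(ℝ)`. -/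
def porbit (Λ : Subgroup ((Fin d → ℝ) ≃ₗ[ℝ] (Fin d → ℝ))) (p : PSpace d) : Set (PSpace d) :=
  {q | ∃ g ∈ Λ, q = pact g p}

/-- The full orbital limit set `L_Ω(Λ)`. -/
def limitSet (Ω : Set (PSpace d)) (Λ : Subgroup ((Fin d → ℝ) ≃ₗ[ℝ] (Fin d → ℝ))) :
    Set (PSpace d) :=
  ⋃ p ∈ Ω, (closure (porbit Λ p) \ porbit Λ p)

/-- The convex hull of `X ⊆ closure Ω` taken inside `Ω`. -/
def convHullIn (Ω X : Set (PSpace d)) : Set (PSpace d) :=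
  {z ∈ Ω | cmap Ω z ∈ convexHull ℝ (cmap Ω '' X)}

/-- `C_Ω(Λ)`: the convex hull of the full orbital limit set in `Ω`. -/
def coreC (Ω : Set (PSpace d)) (Λ : Subgroup ((Fin d → ℝ) ≃ₗ[ℝ] (Fin d → ℝ))) :
    Set (PSpace d) :=
  convHullIn Ω (limitSet Ω Λ)

/-- A convex co-compact group `Λ ⊆ Aut(Ω)`: an infinite discrete subgroup preserving `Ω`
such that `C_Ω(Λ)` is nonempty and `Λ` acts cocompactly on it. -/
structure CCSetup (d : ℕ) where
  Ω : Set (PSpace d)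
  Λ : Subgroup ((Fin d → ℝ) ≃ₗ[ℝ] (Fin d → ℝ))
  isOpen_Ω : IsOpen Ω
  nonempty_Ω : Ω.Nonempty
  properlyConvex_Ω : IsProperlyConvex Ω
  inv_Ω : ∀ g ∈ Λ, pact g '' Ω = Ω
  infinite_Λ : (Λ : Set ((Fin d → ℝ) ≃ₗ[ℝ] (Fin d → ℝ))).Infinite
  discrete_Λ : ∀ K ⊆ Ω, IsCompact K →
    {g : (Fin d → ℝ) ≃ₗ[ℝ] (Fin d → ℝ) | g ∈ Λ ∧ (pact g '' K ∩ K).Nonempty}.Finite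
  core_nonempty : (coreC Ω Λ).Nonempty
  cocompact : ∃ K : Set (PSpace d), K ⊆ coreC Ω Λ ∧ IsCompact K ∧
    coreC Ω Λ ⊆ ⋃ g ∈ Λ, pact g '' K

/-- The Gromov product of `x, y` at `w`, with respect to the Hilbert metric of `Ω`. -/
def gromovProd (Ω : Set (PSpace d)) (w x y : PSpace d) : ℝ :=
  (hilbertDist Ω x w + hilbertDist Ω y w - hilbertDist Ω x y) / 2

/-- `(C, d_Ω)` is Gromov hyperbolic. -/
def GromovHyperbolicOn (Ω C : Set (PSpace d)) : Prop :=
  ∃ δ : ℝ, 0 ≤ δ ∧ ∀ x ∈ C, ∀ y ∈ C, ∀ z ∈ C, ∀ w ∈ C,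
    min (gromovProd Ω w x y) (gromovProd Ω w y z) - δ ≤ gromovProd Ω w x z

/-- The open Hilbert-metric ball in `Ω`. -/
def hBall (Ω : Set (PSpace d)) (x : PSpace d) (r : ℝ) : Set (PSpace d) :=
  {y ∈ Ω | hilbertDist Ω x y < r}

/-- The Hausdorff distance between `A` and `B` (w.r.t. the Hilbert metric of `Ω`)
is less than `ε`. -/
def hausLT (Ω A B : Set (PSpace d)) (ε : ℝ) : Prop :=
  (∀ a ∈ A, ∃ b ∈ B, hilbertDist Ω a b < ε) ∧ ∀ b ∈ B, ∃ a ∈ A, hilbertDist Ω a b < ε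

/-- The Hausdorff distance between `A` and `B` (w.r.t. the Hilbert metric of `Ω`)
is at most `r`. -/
def hausdorffDistLE (Ω A B : Set (PSpace d)) (r : ℝ) : Prop :=
  ∀ ε : ℝ, 0 < ε → hausLT Ω A B (r + ε)

/-- Convergence `F n → C` in the local Hausdorff topology induced by `d_Ω`. -/
def LocalHausConv (Ω : Set (PSpace d)) (F : ℕ → Set (PSpace d)) (C : Set (PSpace d)) : Prop :=
  ∀ x ∈ Ω, ∀ r : ℝ, 0 < r → ∀ ε : ℝ, 0 < ε →
    ∀ᶠ n in atTop, hausLT Ω (F n ∩ hBall Ω x r) (C ∩ hBall Ω x r) ε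

/-- A collection `𝒮` of closed subsets of `Ω` is closed and discrete in the local Hausdorff
topology: any sequence in `𝒮` converging to a nonempty closed subset of `Ω` has limit in `𝒮`
and is eventually equal to its limit. -/
def ClosedAndDiscreteInLHT (Ω : Set (PSpace d)) (𝒮 : Set (Set (PSpace d))) : Prop :=
  ∀ F : ℕ → Set (PSpace d), (∀ n, F n ∈ 𝒮) →
    ∀ C : Set (PSpace d), C.Nonempty → C ⊆ Ω → closure C ∩ Ω ⊆ C → LocalHausConv Ω F C →
      C ∈ 𝒮 ∧ ∀ᶠ n in atTop, F n = C


lemma pspace_cont (S : Set (PSpace d))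
    (h : IsOpen {v : {v : Fin d → ℝ // v ≠ 0} | Projectivization.mk ℝ v.1 v.2 ∈ S}) : IsOpen S := h

lemma pspace_mk_cont : Continuous
    (fun v : {v : Fin d → ℝ // v ≠ 0} => (Projectivization.mk ℝ v.1 v.2 : PSpace d)) :=
  continuous_quotient_mk'

lemma chartMap_mk (f : (Fin d → ℝ) →ₗ[ℝ] ℝ) (v : Fin d → ℝ) (hv : v ≠ 0) :
    chartMap f (Projectivization.mk ℝ v hv) = (f v)⁻¹ • v := by
  obtain ⟨a, ha⟩ := Projectivization.exists_smul_eq_mk_rep ℝ v hv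
  have ha' : (Projectivization.mk ℝ v hv).rep = (a : ℝ) • v := ha.symm
  have h0 : (a : ℝ) ≠ 0 := a.ne_zero
  unfold chartMap
  rw [ha', map_smul, smul_smul, smul_eq_mul, mul_inv, mul_comm (a : ℝ)⁻¹, mul_assoc,
    inv_mul_cancel₀ h0, mul_one]

lemma f_rep_mk (f : (Fin d → ℝ) →ₗ[ℝ] ℝ) (v : Fin d → ℝ) (hv : v ≠ 0) :
    f (Projectivization.mk ℝ v hv).rep ≠ 0 ↔ f v ≠ 0 := by
  obtain ⟨a, ha⟩ := Projectivization.exists_smul_eq_mk_rep ℝ v hv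
  have ha' : (Projectivization.mk ℝ v hv).rep = (a : ℝ) • v := ha.symm
  have h0 : (a : ℝ) ≠ 0 := a.ne_zero
  rw [ha', map_smul]
  simp [h0]

lemma f_chartMap (f : (Fin d → ℝ) →ₗ[ℝ] ℝ) (x : PSpace d) (h : f x.rep ≠ 0) :
    f (chartMap f x) = 1 := by
  unfold chartMap
  rw [map_smul, smul_eq_mul, inv_mul_cancel₀ h]

lemma ne_zero_of_f {f : (Fin d → ℝ) →ₗ[ℝ] ℝ} {v : Fin d → ℝ} (h : f v = 1) : v ≠ 0 := by
  rintro rfl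
  simp at h

lemma mk_chartMap (f : (Fin d → ℝ) →ₗ[ℝ] ℝ) (x : PSpace d) (h : f x.rep ≠ 0)
    (hv : chartMap f x ≠ 0) :
    Projectivization.mk ℝ (chartMap f x) hv = x := by
  conv_rhs => rw [← x.mk_rep]
  rw [Projectivization.mk_eq_mk_iff']
  exact ⟨(f x.rep)⁻¹, rfl⟩

lemma chartMap_contAt (f : (Fin d → ℝ) →ₗ[ℝ] ℝ) (x : PSpace d) (h : f x.rep ≠ 0) :
    ContinuousAt (chartMap f) x := by
  have hfc : Continuous f := f.continuous_of_finiteDimensional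
  rw [ContinuousAt, tendsto_nhds]
  intro U hU hxU
  have ho : IsOpen {p : PSpace d | f p.rep ≠ 0 ∧ chartMap f p ∈ U} := by
    apply pspace_cont
    have : {v : {v : Fin d → ℝ // v ≠ 0} | (Projectivization.mk ℝ v.1 v.2 : PSpace d) ∈
        {p : PSpace d | f p.rep ≠ 0 ∧ chartMap f p ∈ U}} =
        Subtype.val ⁻¹' ({v | f v ≠ 0} ∩ (fun v => (f v)⁻¹ • v) ⁻¹' U) := by
      ext v
      simp only [mem_ofPred_eq, chartMap_mk, f_rep_mk, mem_preimage, mem_inter_iff]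
    rw [this]
    apply IsOpen.preimage continuous_subtype_val
    apply ContinuousOn.isOpen_inter_preimage _ (isOpen_ne_fun hfc continuous_const) hU
    intro v hv
    exact ((hfc.continuousAt.inv₀ hv).smul continuousAt_id).continuousWithinAt
  filter_upwards [ho.mem_nhds ⟨h, hxU⟩] with p hp using hp.2

/-- closure points of the chart image -/
lemma chart_closure {f : (Fin d → ℝ) →ₗ[ℝ] ℝ} {Ω : Set (PSpace d)}
    (hf : ∀ x ∈ closure Ω, f x.rep ≠ 0) {w : Fin d → ℝ} (hw : w ∈ closure (chartMap f '' Ω)) :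
    ∃ z ∈ closure Ω, chartMap f z = w := by
  have hfc : Continuous f := f.continuous_of_finiteDimensional
  have h1 : ∀ w ∈ closure (chartMap f '' Ω), f w = 1 := by
    have : closure (chartMap f '' Ω) ⊆ {w | f w = 1} := by
      apply closure_minimal _ (isClosed_eq hfc continuous_const)
      rintro _ ⟨z, hz, rfl⟩
      exact f_chartMap f z (hf z (subset_closure hz))
    exact this
  have h2 := h1 w hw
  have hw0 := ne_zero_of_f h2
  refine ⟨Projectivization.mk ℝ w hw0, ?_, ?_⟩
  · rw [mem_closure_iff_seq_limit] at hw
    obtain ⟨s, hs, hlim⟩ := hw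
    have hs0 : ∀ n, s n ≠ 0 := fun n => ne_zero_of_f (h1 _ (subset_closure (hs n)))
    have hl : Tendsto (fun n => (⟨s n, hs0 n⟩ : {v : Fin d → ℝ // v ≠ 0})) atTop
        (nhds ⟨w, hw0⟩) := tendsto_subtype_rng.2 hlim
    have hl2 := (pspace_mk_cont.tendsto _).comp hl
    refine mem_closure_of_tendsto hl2 (Eventually.of_forall fun n => ?_)
    obtain ⟨z, hz, hzs⟩ := hs n
    have := mk_chartMap f z (hf z (subset_closure hz)) (by rw [hzs]; exact hs0 n)
    simp only [Function.comp]
    simp only [hzs] at this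
    rw [this]
    exact hz
  · rw [chartMap_mk, h2]; simp

lemma chart_mem_closure {f : (Fin d → ℝ) →ₗ[ℝ] ℝ} {Ω : Set (PSpace d)}
    (hf : ∀ x ∈ closure Ω, f x.rep ≠ 0) {z : PSpace d} (hz : z ∈ closure Ω) :
    chartMap f z ∈ closure (chartMap f '' Ω) :=
  (chartMap_contAt f z (hf z hz)).continuousWithinAt.mem_closure_image hz

lemma chart_inj {f : (Fin d → ℝ) →ₗ[ℝ] ℝ} {z w : PSpace d} (hz : f z.rep ≠ 0) (hw : f w.rep ≠ 0)
    (h : chartMap f z = chartMap f w) : z = w := by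
  rw [← mk_chartMap f z hz (ne_zero_of_f (f_chartMap f z hz)),
    ← mk_chartMap f w hw (ne_zero_of_f (f_chartMap f w hw))]
  congr 1

lemma line_open {f : (Fin d → ℝ) →ₗ[ℝ] ℝ} {Ω : Set (PSpace d)} (ho : IsOpen Ω)
    (hf : ∀ x ∈ closure Ω, f x.rep ≠ 0) {u v : Fin d → ℝ} (hu : f u = 1) (hv : f v = 1) :
    IsOpen {t : ℝ | u + t • (v - u) ∈ chartMap f '' Ω} := by
  have h1 : ∀ t : ℝ, f (u + t • (v - u)) = 1 := by intro t; simp [hu, hv]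
  have hc1 : Continuous (fun t : ℝ => (⟨u + t • (v - u), ne_zero_of_f (h1 t)⟩ :
      {v : Fin d → ℝ // v ≠ 0})) :=
    Continuous.subtype_mk (f := fun t : ℝ => u + t • (v - u)) (by fun_prop)
      (fun t => ne_zero_of_f (h1 t))
  have hc : Continuous (fun t : ℝ => (Projectivization.mk ℝ (u + t • (v - u))
      (ne_zero_of_f (h1 t)) : PSpace d)) := pspace_mk_cont.comp hc1
  convert ho.preimage hc using 1
  ext t
  simp only [mem_ofPred_eq, mem_preimage]
  constructor
  · rintro ⟨z, hz, hzw⟩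
    have := mk_chartMap f z (hf z (subset_closure hz)) (by rw [hzw]; exact ne_zero_of_f (h1 t))
    simp only [hzw] at this
    rw [this]; exact hz
  · intro h
    refine ⟨_, h, ?_⟩
    rw [chartMap_mk, h1 t]; simp

/-- everything needed about the parameters of a line through two points of a domain -/
lemma line_params {O : Set (Fin d → ℝ)} {B : ℝ} (hB : ∀ w ∈ O, ‖w‖ ≤ B) {u v : Fin d → ℝ}
    (huv : u ≠ v) :
    ∀ t ∈ {t : ℝ | u + t • (v - u) ∈ O}, |t| ≤ (B + ‖u‖) / ‖v - u‖ := by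
  intro t ht
  have hn : 0 < ‖v - u‖ := norm_pos_iff.2 (sub_ne_zero.2 huv.symm)
  rw [le_div_iff₀ hn]
  have h1 : ‖t • (v - u)‖ = |t| * ‖v - u‖ := by rw [norm_smul, Real.norm_eq_abs]
  rw [← h1]
  have : t • (v - u) = (u + t • (v - u)) - u := by abel
  rw [this]
  exact (norm_sub_le _ _).trans (by linarith [hB _ ht])

lemma bdd_of_abs {T : Set ℝ} {M : ℝ} (h : ∀ t ∈ T, |t| ≤ M) : BddAbove T ∧ BddBelow T :=
  ⟨⟨M, fun t ht => (abs_le.1 (h t ht)).2⟩, ⟨-M, fun t ht => (abs_le.1 (h t ht)).1⟩⟩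

lemma params_bounds {T : Set ℝ} (hT : IsOpen T) (h0 : (0 : ℝ) ∈ T) (h1 : (1 : ℝ) ∈ T)
    {M : ℝ} (h : ∀ t ∈ T, |t| ≤ M) :
    sInf T < 0 ∧ 1 < sSup T ∧ -M ≤ sInf T ∧ sSup T ≤ M := by
  obtain ⟨ha, hb⟩ := bdd_of_abs h
  refine ⟨?_, ?_, le_csInf ⟨0, h0⟩ fun t ht => (abs_le.1 (h t ht)).1,
    csSup_le ⟨0, h0⟩ fun t ht => (abs_le.1 (h t ht)).2⟩
  · obtain ⟨ε, hε, hball⟩ := Metric.isOpen_iff.1 hT 0 h0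
    have : -(ε / 2) ∈ T := hball (by simp [abs_of_pos hε]; linarith)
    linarith [csInf_le hb this]
  · obtain ⟨ε, hε, hball⟩ := Metric.isOpen_iff.1 hT 1 h1
    have : 1 + ε / 2 ∈ T := hball (by simp [abs_of_pos hε]; linarith)
    linarith [le_csSup ha this]

lemma ratio_ge_one {P Q : ℝ} (hQ : Q < 0) (hP : 1 < P) :
    1 ≤ (P * (1 - Q)) / ((-Q) * (P - 1)) := by
  rw [le_div_iff₀ (mul_pos (by linarith) (by linarith))]
  nlinarith

lemma ratio_of_lt {P Q R : ℝ} (hQ : Q < 0) (hP : 1 < P)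
    (h : 1 / 2 * Real.log ((P * (1 - Q)) / ((-Q) * (P - 1))) < R) :
    P * (1 - Q) ≤ Real.exp (2 * R) * ((-Q) * (P - 1)) := by
  rw [← div_le_iff₀ (mul_pos (by linarith) (by linarith))]
  have h1 := ratio_ge_one hQ hP
  rw [← Real.log_le_iff_le_exp (by linarith)]
  linarith

/-- face points in a chart -/
lemma seg_eps {E : Type*} [AddCommGroup E] [Module ℝ E] {C : Set E} (hC : Convex ℝ C) {a b u v : E}
    (ha : a ∈ C) (hb : b ∈ C) (hu : u ∈ openSegment ℝ a b) (hv : v ∈ openSegment ℝ a b) :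
    ∃ ε > (0 : ℝ), ∀ e : ℝ, 0 ≤ e → e ≤ ε → u - e • (v - u) ∈ C ∧ v + e • (v - u) ∈ C := by
  rw [openSegment_eq_image'] at hu hv
  obtain ⟨s, ⟨hs0, hs1⟩, rfl⟩ := hu
  obtain ⟨t, ⟨ht0, ht1⟩, rfl⟩ := hv
  have key : ∀ r : ℝ, 0 ≤ r → r ≤ 1 → a + r • (b - a) ∈ C := fun r h0 h1 =>
    hC.add_smul_sub_mem ha hb ⟨h0, h1⟩
  refine ⟨min (min s (1 - s)) (min t (1 - t)),
    lt_min (lt_min hs0 (by linarith)) (lt_min ht0 (by linarith)), fun e he0 he => ?_⟩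
  simp only [le_min_iff] at he
  obtain ⟨⟨e1, e2⟩, e3, e4⟩ := he
  constructor
  · convert key (s - e * (t - s)) (by nlinarith) (by nlinarith) using 1
    module
  · convert key (t + e * (t - s)) (by nlinarith) (by nlinarith) using 1
    module

lemma eps_seg {E : Type*} [AddCommGroup E] [Module ℝ E] {u v : E} {p q t : ℝ}
    (hp : p < t) (hq : t < q)  :
    u + t • (v - u) ∈ openSegment ℝ (u + p • (v - u)) (u + q • (v - u)) := by
  rw [openSegment_eq_image']
  refine ⟨(t - p) / (q - p), ⟨div_pos (by linarith) (by linarith), ?_⟩, ?_⟩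
  · rw [div_lt_one (by linarith)]; linarith
  · have : q - p ≠ 0 := by linarith
    have h2 : t = p + (t - p) / (q - p) * (q - p) := by field_simp; ring
    conv_rhs => rw [h2]
    module

lemma proj_ratio {T : Set ℝ} {M s t α β K : ℝ} (hM : ∀ τ ∈ T, |τ| ≤ M) (hs : s < 0) (ht : 1 < t)
    (hα : α ≠ 0)
    (hT : ∀ τ, s < τ → τ < t → α + τ * (β - α) ≠ 0 ∧ τ * β / (α + τ * (β - α)) ∈ T)
    (hK : t * (1 - s) ≤ K * ((-s) * (t - 1))) :
    1 / 2 * Real.log ((sSup T * (1 - sInf T)) / ((-(sInf T)) * (sSup T - 1)))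
      ≤ 1 / 2 * Real.log K := by
  obtain ⟨ha, hb⟩ := bdd_of_abs hM
  set P := sSup T
  set Q := sInf T
  obtain ⟨γ, hγ⟩ : ∃ γ, γ = β / α := ⟨_, rfl⟩
  have hβ : β = γ * α := by rw [hγ]; field_simp
  have hD : ∀ τ, α + τ * (β - α) = α * (1 + (γ - 1) * τ) := by intro τ; rw [hβ]; ring
  have hT2 : ∀ τ ∈ Ioo s t, 1 + (γ - 1) * τ ≠ 0 := by
    rintro τ ⟨h1, h2⟩ h
    apply (hT τ h1 h2).1
    rw [hD, h, mul_zero]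
  have hpos : ∀ τ ∈ Ioo s t, 0 < 1 + (γ - 1) * τ := by
    intro τ hτ
    by_contra hneg
    push Not at hneg
    have := isPreconnected_Ioo.intermediate_value hτ (show (0 : ℝ) ∈ Ioo s t from ⟨hs, by linarith⟩)
      (f := fun τ => 1 + (γ - 1) * τ) (by fun_prop)
    obtain ⟨r, hr, hr0⟩ := this (show (0 : ℝ) ∈ Icc _ _ from ⟨hneg, by simp⟩)
    exact hT2 r hr hr0
  have hT3 : ∀ τ ∈ Ioo s t, τ * γ / (1 + (γ - 1) * τ) ∈ T := by
    intro τ hτ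
    convert (hT τ hτ.1 hτ.2).2 using 1
    rw [hD, hβ]
    have := (hpos τ hτ).ne'
    field_simp
  have hγ0 : 0 < γ := by
    have := hpos 1 ⟨by linarith, ht⟩
    linarith
  have h1T : (1 : ℝ) ∈ T := by
    convert hT3 1 ⟨by linarith, ht⟩ using 1
    rw [eq_div_iff (by linarith)]; ring
  have h0T : (0 : ℝ) ∈ T := by
    convert hT3 0 ⟨by linarith, by linarith⟩ using 1
    simp
  have hP1 : 1 ≤ P := le_csSup ha h1T
  have hQ0 : Q ≤ 0 := csInf_le hb h0T
  have hst : s ≠ t := by linarith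
  have hP : t * γ ≤ P * (1 + (γ - 1) * t) := by
    have hsub : closure (Ioo s t) ⊆ {τ | τ * γ ≤ P * (1 + (γ - 1) * τ)} := by
      apply closure_minimal _ (isClosed_le (by fun_prop) (by fun_prop))
      intro τ hτ
      have := le_csSup ha (hT3 τ hτ)
      rwa [div_le_iff₀ (hpos τ hτ)] at this
    rw [closure_Ioo hst] at hsub
    exact hsub ⟨by linarith, le_refl t⟩
  have hQ : Q * (1 + (γ - 1) * s) ≤ s * γ := by
    have hsub : closure (Ioo s t) ⊆ {τ | Q * (1 + (γ - 1) * τ) ≤ τ * γ} := by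
      apply closure_minimal _ (isClosed_le (by fun_prop) (by fun_prop))
      intro τ hτ
      have := csInf_le hb (hT3 τ hτ)
      rwa [le_div_iff₀ (hpos τ hτ)] at this
    rw [closure_Ioo hst] at hsub
    exact hsub ⟨le_refl s, by linarith⟩
  have e1 : P * (t - 1) ≤ t * γ * (P - 1) := by nlinarith
  have e2 : (-s) * γ * (1 - Q) ≤ (-Q) * (1 - s) := by nlinarith
  have p1 : 0 < P * (t - 1) := mul_pos (by linarith) (by linarith)
  have p2 : 0 < (-s) * γ * (1 - Q) := mul_pos (mul_pos (by linarith) hγ0) (by linarith)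
  have hP' : 0 < P - 1 := pos_of_mul_pos_right (p1.trans_le e1) (by nlinarith)
  have hQ' : 0 < -Q := pos_of_mul_pos_left (p2.trans_le e2) (by linarith)
  have e3 := mul_le_mul e1 e2 p2.le (mul_pos (mul_pos (by linarith) hγ0) hP').le
  have hst' : 0 < (-s) * (t - 1) := mul_pos (by linarith) (by linarith)
  have e4 : P * (1 - Q) * ((-s) * (t - 1)) ≤ (P - 1) * (-Q) * (t * (1 - s)) := by
    have : γ * (P * (1 - Q) * ((-s) * (t - 1))) ≤ γ * ((P - 1) * (-Q) * (t * (1 - s))) := by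
      linarith
    exact le_of_mul_le_mul_left this hγ0
  have e5 := mul_le_mul_of_nonneg_left hK (mul_pos hP' hQ').le
  have e6 : P * (1 - Q) * ((-s) * (t - 1)) ≤ K * ((-Q) * (P - 1)) * ((-s) * (t - 1)) := by
    linarith
  have e7 := le_of_mul_le_mul_right e6 hst'
  have hpq := ratio_ge_one (P := P) (Q := Q) (by linarith) (by linarith)
  have : (P * (1 - Q)) / ((-Q) * (P - 1)) ≤ K := by
    rw [div_le_iff₀ (mul_pos hQ' hP')]; exact e7
  have := Real.log_le_log (by linarith) this
  linarith

lemma chartOf_spec {C : Set (PSpace d)} (h : IsProperlyConvex C) :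
    (∀ x ∈ closure C, chartOf C x.rep ≠ 0) ∧
    Convex ℝ (cmap C '' C) ∧ Bornology.IsBounded (cmap C '' C) := by
  unfold cmap chartOf
  rw [dif_pos h]
  exact h.choose_spec

lemma face_sub {Ω : Set (PSpace d)} {x : PSpace d} (hx : x ∈ closure Ω) :
    face Ω x ⊆ closure Ω := by
  rintro y (rfl | h)
  · exact hx
  · exact h.1

lemma mem_face_of_seg {Ω : Set (PSpace d)} (h : IsProperlyConvex Ω) {x y : PSpace d}
    (hx : x ∈ closure Ω) (hy : y ∈ closure Ω) {a b : Fin d → ℝ}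
    (ha : a ∈ closure (cmap Ω '' Ω)) (hb : b ∈ closure (cmap Ω '' Ω))
    (h1 : cmap Ω x ∈ openSegment ℝ a b) (h2 : cmap Ω y ∈ openSegment ℝ a b) :
    y ∈ face Ω x := by
  obtain ⟨hf, -, -⟩ := chartOf_spec h
  obtain ⟨a', ha', rfl⟩ := chart_closure hf ha
  obtain ⟨b', hb', rfl⟩ := chart_closure hf hb
  exact Or.inr ⟨hy, a', ha', b', hb', ⟨hx, h1⟩, ⟨hy, h2⟩⟩

lemma face_eps {Ω : Set (PSpace d)} (h : IsProperlyConvex Ω) {x y : PSpace d}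
    (hx : x ∈ closure Ω) (hy : y ∈ face Ω x) :
    ∃ ε > (0 : ℝ), ∀ e : ℝ, 0 ≤ e → e ≤ ε →
      cmap Ω x - e • (cmap Ω y - cmap Ω x) ∈ closure (cmap Ω '' Ω) ∧
      cmap Ω y + e • (cmap Ω y - cmap Ω x) ∈ closure (cmap Ω '' Ω) := by
  obtain ⟨hf, hc, -⟩ := chartOf_spec h
  rcases hy with rfl | ⟨hy, a, ha, b, hb, h1, h2⟩
  · refine ⟨1, one_pos, fun e _ _ => ?_⟩
    simp only [sub_self, smul_zero, sub_zero, add_zero, and_self]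
    exact chart_mem_closure hf hx
  · exact seg_eps hc.closure (chart_mem_closure hf ha) (chart_mem_closure hf hb) h1.2 h2.2

lemma face_pc {Ω : Set (PSpace d)} (h : IsProperlyConvex Ω) {x : PSpace d}
    (hx : x ∈ closure Ω) : IsProperlyConvex (face Ω x) := by
  obtain ⟨hf, hc, hbd⟩ := chartOf_spec h
  refine ⟨chartOf Ω, fun z hz => hf z (closure_minimal (face_sub hx) isClosed_closure hz), ?_, ?_⟩
  · rintro _ ⟨y, hy, rfl⟩ _ ⟨z, hz, rfl⟩ p q hp hq hpq
    change p • cmap Ω y + q • cmap Ω z ∈ cmap Ω '' _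
    have hcc := hc.closure
    have hwC : p • cmap Ω y + q • cmap Ω z ∈ closure (cmap Ω '' Ω) :=
      hcc (chart_mem_closure hf (face_sub hx hy)) (chart_mem_closure hf (face_sub hx hz)) hp hq hpq
    obtain ⟨w, hw, hweq⟩ := chart_closure hf hwC
    change cmap Ω w = _ at hweq
    refine ⟨w, ?_, hweq⟩
    obtain ⟨e1, he1, hy'⟩ := face_eps h hx hy
    obtain ⟨e2, he2, hz'⟩ := face_eps h hx hz
    set e := min e1 e2
    have he : 0 < e := lt_min he1 he2
    obtain ⟨y1, y2⟩ := hy' e he.le (min_le_left _ _)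
    obtain ⟨z1, z2⟩ := hz' e he.le (min_le_right _ _)
    have hq' : p = 1 - q := by linarith
    have c1 := hcc y1 z1 hp hq hpq
    have c2 := hcc y2 z2 hp hq hpq
    have d1 : cmap Ω x + (-e) • (cmap Ω w - cmap Ω x) ∈ closure (cmap Ω '' Ω) := by
      convert c1 using 1
      rw [hweq, hq']; module
    have d2 : cmap Ω x + (1 + e) • (cmap Ω w - cmap Ω x) ∈ closure (cmap Ω '' Ω) := by
      convert c2 using 1
      rw [hweq, hq']; module
    apply mem_face_of_seg h hx hw d1 d2
    · convert eps_seg (u := cmap Ω x) (v := cmap Ω w) (p := -e) (q := 1 + e) (t := 0)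
        (by linarith) (by linarith) using 1
      module
    · convert eps_seg (u := cmap Ω x) (v := cmap Ω w) (p := -e) (q := 1 + e) (t := 1)
        (by linarith) (by linarith) using 1
      module
  · refine hbd.closure.subset ?_
    rintro _ ⟨y, hy, rfl⟩
    exact chart_mem_closure hf (face_sub hx hy)

lemma chart_change {f g : (Fin d → ℝ) →ₗ[ℝ] ℝ} {x : PSpace d} (hf : f x.rep ≠ 0)
    (hg : g x.rep ≠ 0) :
    g (chartMap f x) ≠ 0 ∧ chartMap g x = (g (chartMap f x))⁻¹ • chartMap f x := by
  have h0 := ne_zero_of_f (f_chartMap f x hf)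
  have h1 := mk_chartMap f x hf h0
  constructor
  · rw [← f_rep_mk g _ h0, h1]; exact hg
  · rw [← chartMap_mk g _ h0, h1]

lemma face_dist {Ω : Set (PSpace d)} (h : IsProperlyConvex Ω) {x y : PSpace d}
    (hx : x ∈ closure Ω) (hy : y ∈ closure Ω) (hxy : x ≠ y) {s t K : ℝ} (hs : s < 0) (ht : 1 < t)
    (hK : t * (1 - s) ≤ K * ((-s) * (t - 1)))
    (h1 : cmap Ω x + s • (cmap Ω y - cmap Ω x) ∈ closure (cmap Ω '' Ω))
    (h2 : cmap Ω x + t • (cmap Ω y - cmap Ω x) ∈ closure (cmap Ω '' Ω)) :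
    y ∈ face Ω x ∧ hilbertDist (face Ω x) x y ≤ 1 / 2 * Real.log K := by
  obtain ⟨hf, hc, hbd⟩ := chartOf_spec h
  have hseg : ∀ τ, s < τ → τ < t → ∃ z ∈ face Ω x,
      cmap Ω z = cmap Ω x + τ • (cmap Ω y - cmap Ω x) := by
    intro τ hτ1 hτ2
    have hm := eps_seg (u := cmap Ω x) (v := cmap Ω y) hτ1 hτ2
    obtain ⟨z, hz, hze⟩ := chart_closure hf (hc.closure.openSegment_subset h1 h2 hm)
    change cmap Ω z = _ at hze
    refine ⟨z, mem_face_of_seg h hx hz h1 h2 ?_ (by rw [hze]; exact hm), hze⟩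
    convert eps_seg (u := cmap Ω x) (v := cmap Ω y) (p := s) (q := t) (t := 0)
        (by linarith) (by linarith) using 1
    module
  have hyF : y ∈ face Ω x := by
    obtain ⟨z, hz, hze⟩ := hseg 1 (by linarith) ht
    rw [one_smul, add_sub_cancel] at hze
    rwa [← chart_inj (hf z (face_sub hx hz)) (hf y hy) hze]
  refine ⟨hyF, ?_⟩
  have hxF : x ∈ face Ω x := Or.inl rfl
  obtain ⟨hg, -, hgb⟩ := chartOf_spec (face_pc h hx)
  have hg' : ∀ z ∈ face Ω x, chartOf (face Ω x) z.rep ≠ 0 := fun z hz => hg z (subset_closure hz)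
  have huv : cmap (face Ω x) x ≠ cmap (face Ω x) y := fun he =>
    hxy (chart_inj (hg' x hxF) (hg' y hyF) he)
  unfold hilbertDist hilbertDistChart
  rw [if_neg huv]
  obtain ⟨B, hB⟩ := hgb.exists_norm_le
  obtain ⟨cx0, cx⟩ := chart_change (hf x hx) (hg' x hxF)
  obtain ⟨cy0, cy⟩ := chart_change (hf y hy) (hg' y hyF)
  refine proj_ratio (line_params hB huv) hs ht cx0
    (β := chartOf (face Ω x) (cmap Ω y)) (fun τ hτ1 hτ2 => ?_) hK
  obtain ⟨z, hz, hze⟩ := hseg τ hτ1 hτ2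
  obtain ⟨cz0, cz⟩ := chart_change (hf z (face_sub hx hz)) (hg' z hz)
  change cmap (face Ω x) z = _ • cmap Ω z at cz
  change cmap (face Ω x) x = _ • cmap Ω x at cx
  change cmap (face Ω x) y = _ • cmap Ω y at cy
  change chartOf (face Ω x) (cmap Ω x) ≠ 0 at cx0
  change chartOf (face Ω x) (cmap Ω y) ≠ 0 at cy0
  change chartOf (face Ω x) (cmap Ω z) ≠ 0 at cz0
  have hgz : chartOf (face Ω x) (cmap Ω z) = chartOf (face Ω x) (cmap Ω x) +
      τ * (chartOf (face Ω x) (cmap Ω y) - chartOf (face Ω x) (cmap Ω x)) := by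
    rw [hze]; simp
  change chartOf (face Ω x) (cmap Ω x) +
      τ * (chartOf (face Ω x) (cmap Ω y) - chartOf (face Ω x) (cmap Ω x)) ≠ 0 ∧
      τ * chartOf (face Ω x) (cmap Ω y) / (chartOf (face Ω x) (cmap Ω x) +
      τ * (chartOf (face Ω x) (cmap Ω y) - chartOf (face Ω x) (cmap Ω x))) ∈ _
  refine ⟨by rw [← hgz]; exact cz0, z, hz, ?_⟩
  change chartMap _ z = _ • cmap Ω z at cz
  rw [show cmap (face Ω x) z = _ from cz, cx, cy]
  change (chartOf (face Ω x) (cmap Ω z))⁻¹ • cmap Ω z =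
    (chartOf (face Ω x) (cmap Ω x))⁻¹ • cmap Ω x + _ • (
      (chartOf (face Ω x) (cmap Ω y))⁻¹ • cmap Ω y - (chartOf (face Ω x) (cmap Ω x))⁻¹ • cmap Ω x)
  rw [hgz] at cz0 ⊢
  rw [hze]
  generalize chartOf (face Ω x) (cmap Ω x) = α at *
  generalize chartOf (face Ω x) (cmap Ω y) = β at *
  match_scalars
  · field_simp
    ring
  · field_simp

/-- Proposition 2.5: if `x_n → x`, `y_n → y` in `closure Ω` and
`liminf d_Ω(x_n, y_n) < ∞`, then `y ∈ F_Ω(x)` and `d_{F_Ω(x)}(x,y) ≤ liminf d_Ω(x_n,y_n)`. -/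
theorem face_distance_estimate {d : ℕ} (Ω : Set (PSpace d)) (hΩ : IsPCDomain Ω)
    (xs ys : ℕ → PSpace d) (hxs : ∀ n, xs n ∈ Ω) (hys : ∀ n, ys n ∈ Ω)
    (x y : PSpace d) (hx : x ∈ closure Ω) (hy : y ∈ closure Ω)
    (hxlim : Tendsto xs atTop (nhds x)) (hylim : Tendsto ys atTop (nhds y))
    (hfin : liminf (fun n => (hilbertDist Ω (xs n) (ys n) : EReal)) atTop < ⊤) :
    y ∈ face Ω x ∧
      (hilbertDist (face Ω x) x y : EReal) ≤
        liminf (fun n => (hilbertDist Ω (xs n) (ys n) : EReal)) atTop := by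
  obtain ⟨ho, hne, hpc⟩ := hΩ
  obtain ⟨hf, hc, hbd⟩ := chartOf_spec hpc
  obtain ⟨B, hB⟩ := hbd.exists_norm_le
  have hmem : ∀ z ∈ Ω, cmap Ω z ∈ cmap Ω '' Ω := fun z hz => ⟨z, hz, rfl⟩
  have hf1 : ∀ z ∈ closure Ω, chartOf Ω (cmap Ω z) = 1 := fun z hz => f_chartMap _ z (hf z hz)
  have h0T : ∀ n, (0 : ℝ) ∈
      {t : ℝ | cmap Ω (xs n) + t • (cmap Ω (ys n) - cmap Ω (xs n)) ∈ cmap Ω '' Ω} := by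
    intro n
    rw [mem_ofPred_eq, zero_smul, add_zero]
    exact hmem _ (hxs n)
  have h1T : ∀ n, (1 : ℝ) ∈
      {t : ℝ | cmap Ω (xs n) + t • (cmap Ω (ys n) - cmap Ω (xs n)) ∈ cmap Ω '' Ω} := by
    intro n
    rw [mem_ofPred_eq, one_smul, add_sub_cancel]
    exact hmem _ (hys n)
  have hline := fun n (hn : cmap Ω (xs n) ≠ cmap Ω (ys n)) =>
    params_bounds (line_open ho hf (hf1 _ (subset_closure (hxs n)))
      (hf1 _ (subset_closure (hys n)))) (h0T n) (h1T n) (line_params hB hn)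
  by_cases hxy : x = y
  · subst hxy
    refine ⟨Or.inl rfl, ?_⟩
    have h0 : hilbertDist (face Ω x) x x = 0 := by
      unfold hilbertDist hilbertDistChart
      rw [if_pos rfl]
    rw [h0]
    refine le_liminf_of_le (by isBoundedDefault) (Eventually.of_forall fun n => ?_)
    rw [EReal.coe_le_coe_iff]
    unfold hilbertDist hilbertDistChart
    split_ifs with hn
    · exact le_rfl
    · obtain ⟨hQ, hP, -, -⟩ := hline n hn
      have := Real.log_nonneg (ratio_ge_one hQ hP)
      exact mul_nonneg (by norm_num) this
  have huv : cmap Ω x ≠ cmap Ω y := fun he => hxy (chart_inj (hf x hx) (hf y hy) he)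
  have hux : Tendsto (fun n => cmap Ω (xs n)) atTop (nhds (cmap Ω x)) :=
    (chartMap_contAt _ x (hf x hx)).tendsto.comp hxlim
  have hvy : Tendsto (fun n => cmap Ω (ys n)) atTop (nhds (cmap Ω y)) :=
    (chartMap_contAt _ y (hf y hy)).tendsto.comp hylim
  have hdpos : 0 < ‖cmap Ω y - cmap Ω x‖ := norm_pos_iff.2 (sub_ne_zero.2 huv.symm)
  obtain ⟨δ, hδ0, hδ⟩ := exists_between hdpos
  have hev : ∀ᶠ n in atTop, δ < ‖cmap Ω (ys n) - cmap Ω (xs n)‖ :=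
    (hvy.sub hux).norm.eventually_const_lt hδ
  have hevne : ∀ n, δ < ‖cmap Ω (ys n) - cmap Ω (xs n)‖ → cmap Ω (xs n) ≠ cmap Ω (ys n) := by
    intro n hn he
    rw [he, sub_self, norm_zero] at hn
    linarith
  have claim : ∀ R : ℝ, liminf (fun n => (hilbertDist Ω (xs n) (ys n) : EReal)) atTop < R →
      y ∈ face Ω x ∧ hilbertDist (face Ω x) x y ≤ R := by
    intro R hR
    have hfr := frequently_lt_of_liminf_lt (by isBoundedDefault) hR
    obtain ⟨T, hT⟩ : ∃ T : ℕ → Set ℝ, ∀ n, T n =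
      {t : ℝ | cmap Ω (xs n) + t • (cmap Ω (ys n) - cmap Ω (xs n)) ∈ cmap Ω '' Ω} :=
      ⟨_, fun n => rfl⟩
    let S : Set (ℝ × ℝ) := (Icc (-((B + B) / δ)) 0 ×ˢ Icc 1 ((B + B) / δ)) ∩
      {p | p.2 * (1 - p.1) ≤ Real.exp (2 * R) * ((-p.1) * (p.2 - 1))}
    have hS : IsCompact S := (isCompact_Icc.prod isCompact_Icc).inter_right
      (isClosed_le (by fun_prop) (by fun_prop))
    have hin : ∃ᶠ n in atTop, (sInf (T n), sSup (T n)) ∈ S := by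
      refine (hfr.and_eventually hev).mono ?_
      rintro n ⟨hn1, hn2⟩
      have hn := hevne n hn2
      have hl := hline n hn
      rw [EReal.coe_lt_coe_iff] at hn1
      unfold hilbertDist hilbertDistChart at hn1
      rw [if_neg hn, ← hT] at hn1
      change sInf {t : ℝ | cmap Ω (xs n) + t • (cmap Ω (ys n) - cmap Ω (xs n)) ∈ cmap Ω '' Ω} < 0 ∧
        1 < sSup {t : ℝ | cmap Ω (xs n) + t • (cmap Ω (ys n) - cmap Ω (xs n)) ∈ cmap Ω '' Ω} ∧
        _ ≤ sInf {t : ℝ | cmap Ω (xs n) + t • (cmap Ω (ys n) - cmap Ω (xs n)) ∈ cmap Ω '' Ω} ∧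
        sSup {t : ℝ | cmap Ω (xs n) + t • (cmap Ω (ys n) - cmap Ω (xs n)) ∈ cmap Ω '' Ω} ≤ _ at hl
      rw [← hT] at hl
      obtain ⟨hQ, hP, hQM, hPM⟩ := hl
      have hBx := hB _ (hmem _ (hxs n))
      have hB0 : 0 ≤ B := (norm_nonneg _).trans hBx
      have hM : (B + ‖cmap Ω (xs n)‖) / ‖cmap Ω (ys n) - cmap Ω (xs n)‖ ≤ (B + B) / δ := by
        gcongr
      exact ⟨⟨⟨by linarith, hQ.le⟩, ⟨hP.le, by linarith⟩⟩, ratio_of_lt hQ hP hn1⟩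
    obtain ⟨⟨s, t⟩, ⟨⟨⟨hs1, hs2⟩, ⟨ht1, ht2⟩⟩, hK⟩, φ, hφ, hlim⟩ := hS.tendsto_subseq' hin
    change t * (1 - s) ≤ Real.exp (2 * R) * ((-s) * (t - 1)) at hK
    simp only at hs1 hs2 ht1 ht2
    have hlims : Tendsto (fun n => sInf (T (φ n))) atTop (nhds s) :=
      (continuous_fst.tendsto _).comp hlim
    have hlimt : Tendsto (fun n => sSup (T (φ n))) atTop (nhds t) :=
      (continuous_snd.tendsto _).comp hlim
    have hpos : 0 < Real.exp (2 * R) * ((-s) * (t - 1)) := by nlinarith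
    have hs : s < 0 := by
      rcases hs2.lt_or_eq with h | h
      · exact h
      · rw [h] at hpos; simp at hpos
    have ht : 1 < t := by
      rcases ht1.lt_or_eq with h | h
      · exact h
      · rw [← h] at hpos; simp at hpos
    have hux' := hux.comp hφ.tendsto_atTop
    have hvy' := hvy.comp hφ.tendsto_atTop
    have hev' := hφ.tendsto_atTop.eventually hev
    have hcl : ∀ n, δ < ‖cmap Ω (ys n) - cmap Ω (xs n)‖ → ∀ r ∈ closure (T n),
        cmap Ω (xs n) + r • (cmap Ω (ys n) - cmap Ω (xs n)) ∈ closure (cmap Ω '' Ω) := by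
      intro n hn r hr
      refine map_mem_closure (f := fun r : ℝ => cmap Ω (xs n) + r • (cmap Ω (ys n) - cmap Ω (xs n)))
        (by fun_prop) hr ?_
      intro r hr
      rw [hT] at hr
      exact hr
    have hTb : ∀ n, δ < ‖cmap Ω (ys n) - cmap Ω (xs n)‖ → (T n).Nonempty ∧
        BddAbove (T n) ∧ BddBelow (T n) := by
      intro n hn
      rw [hT]
      refine ⟨⟨0, h0T n⟩, bdd_of_abs (line_params hB (hevne n hn))⟩
    have h1 : cmap Ω x + s • (cmap Ω y - cmap Ω x) ∈ closure (cmap Ω '' Ω) := by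
      refine isClosed_closure.mem_of_tendsto (hux'.add (hlims.smul (hvy'.sub hux'))) ?_
      filter_upwards [hev'] with n hn
      exact hcl _ hn _ (csInf_mem_closure (hTb _ hn).1 (hTb _ hn).2.2)
    have h2 : cmap Ω x + t • (cmap Ω y - cmap Ω x) ∈ closure (cmap Ω '' Ω) := by
      refine isClosed_closure.mem_of_tendsto (hux'.add (hlimt.smul (hvy'.sub hux'))) ?_
      filter_upwards [hev'] with n hn
      exact hcl _ hn _ (csSup_mem_closure (hTb _ hn).1 (hTb _ hn).2.1)
    obtain ⟨hF, hd⟩ := face_dist hpc hx hy hxy hs ht hK h1 h2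
    refine ⟨hF, hd.trans ?_⟩
    rw [Real.log_exp]
    linarith
  constructor
  · obtain ⟨R, hR, -⟩ := EReal.lt_iff_exists_real_btwn.1 hfin
    exact (claim R hR).1
  · refine le_of_forall_gt_imp_ge_of_dense fun c hc => ?_
    obtain ⟨R, hR, hRc⟩ := EReal.lt_iff_exists_real_btwn.1 hc
    exact (EReal.coe_le_coe_iff.2 (claim R hR).2).trans hRc.le

end Paper
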